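/- Let S be a finite thick generalized quadrangle in which the full group Ẽ(x) of symmetries with center x is nontrivial for every point x, and let r be a prime such that P_r = {y : r divides |Ẽ(y)|} is nonempty. Then P_r has at least 3 elements, and P_r is not contained in the point set of a single line. -/

import Mathlib

open Equiv

section GQDefs

variable {P L : Type*}

/-- A generalized quadrangle of order `(s,t)`: every line has `s+1` points, every point is
on `t+1` lines, two distinct points are on at most one common line, and for every
non-incident point-line pair `(p, ℓ)` there is a unique pair `(q, M)` with `M` a line
through `p` and `q` a point incident with both `M` and `ℓ`. -/
structure IsGQ (I : P → L → Prop) (s t : ℕ) : Prop where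
  point_count : ∀ ℓ : L, Nat.card {p : P // I p ℓ} = s + 1
  line_count : ∀ p : P, Nat.card {ℓ : L // I p ℓ} = t + 1
  unique_line : ∀ ⦃p q : P⦄, p ≠ q → ∀ ⦃ℓ m : L⦄, I p ℓ → I q ℓ → I p m → I q m → ℓ = m
  quad : ∀ ⦃p : P⦄ ⦃ℓ : L⦄, ¬ I p ℓ →
    ∃! qM : P × L, I p qM.2 ∧ I qM.1 qM.2 ∧ I qM.1 ℓ

/-- Two points are collinear if some line is incident with both. -/
def Coll (I : P → L → Prop) (x y : P) : Prop := ∃ ℓ : L, I x ℓ ∧ I y ℓ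

/-- The automorphism group of an incidence structure, as a subgroup of
`Perm P × Perm L`: pairs of permutations preserving incidence. -/
def autGroup (I : P → L → Prop) : Subgroup (Perm P × Perm L) where
  carrier := {g | ∀ p ℓ, I (g.1 p) (g.2 ℓ) ↔ I p ℓ}
  one_mem' := fun _ _ => Iff.rfl
  mul_mem' := fun {a b} ha hb p ℓ => (ha (b.1 p) (b.2 ℓ)).trans (hb p ℓ)
  inv_mem' := by
    intro a ha p ℓ
    have h := ha (a⁻¹.1 p) (a⁻¹.2 ℓ)
    simpa using h.symm

/-- The full group `Ẽ(p)` of symmetries with center `p`: automorphisms fixing every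
point collinear with `p`. -/
def symmGroup (I : P → L → Prop) (p : P) : Subgroup (Perm P × Perm L) where
  carrier := {g | g ∈ autGroup I ∧ ∀ y : P, Coll I p y → g.1 y = y}
  one_mem' := ⟨(autGroup I).one_mem, fun _ _ => rfl⟩
  mul_mem' := by
    rintro a b ⟨ha, ha'⟩ ⟨hb, hb'⟩
    refine ⟨(autGroup I).mul_mem ha hb, fun y hy => ?_⟩
    have : (a * b).1 y = a.1 (b.1 y) := rfl
    rw [this, hb' y hy, ha' y hy]
  inv_mem' := by
    rintro a ⟨ha, ha'⟩
    refine ⟨(autGroup I).inv_mem ha, fun y hy => ?_⟩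
    have h : a⁻¹.1 (a.1 y) = y := by simp
    rw [ha' y hy] at h
    exact h

/-- `x^⊥`: the set of points collinear with `x` (including `x` itself). -/
def perpSet (I : P → L → Prop) (x : P) : Set P := {y | Coll I x y}

/-- The hyperbolic line `{x,y}^{⊥⊥}`: points collinear with every point of
`{x,y}^⊥ = x^⊥ ∩ y^⊥`. -/
def hypLine (I : P → L → Prop) (x y : P) : Set P :=
  {z | ∀ w ∈ perpSet I x ∩ perpSet I y, Coll I z w}

/-- The group `G` generated by all the point-symmetries of the quadrangle. -/
def bigGroup (I : P → L → Prop) : Subgroup (Perm P × Perm L) :=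
  ⨆ x : P, symmGroup I x

/-- The set `P_r` of `r`-points: points whose full group of symmetries has order
divisible by `r`. -/
def Pr (I : P → L → Prop) (r : ℕ) : Set P :=
  {y | r ∣ Nat.card (symmGroup I y)}

/-- The set `L_r` of lines incident with at least two points of `P_r`. -/
def Lr (I : P → L → Prop) (r : ℕ) : Set L :=
  {ℓ | ∃ x y : P, x ≠ y ∧ x ∈ Pr I r ∧ y ∈ Pr I r ∧ I x ℓ ∧ I y ℓ}

/-- The stabilizer `G_u` of a point `u` in a group `G` of automorphisms. -/
def stabPt (G : Subgroup (Perm P × Perm L)) (u : P) : Subgroup (Perm P × Perm L) where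
  carrier := {g | g ∈ G ∧ g.1 u = u}
  one_mem' := ⟨G.one_mem, rfl⟩
  mul_mem' := by
    rintro a b ⟨ha, ha'⟩ ⟨hb, hb'⟩
    refine ⟨G.mul_mem ha hb, ?_⟩
    have : (a * b).1 u = a.1 (b.1 u) := rfl
    rw [this, hb', ha']
  inv_mem' := by
    rintro a ⟨ha, ha'⟩
    refine ⟨G.inv_mem ha, ?_⟩
    have h : a⁻¹.1 (a.1 u) = u := by simp
    rw [ha'] at h
    exact h

/-- The setwise stabilizer `G_ℓ` of a line `ℓ` in a group `G` of automorphisms. -/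
def stabLine (G : Subgroup (Perm P × Perm L)) (ℓ : L) : Subgroup (Perm P × Perm L) where
  carrier := {g | g ∈ G ∧ g.2 ℓ = ℓ}
  one_mem' := ⟨G.one_mem, rfl⟩
  mul_mem' := by
    rintro a b ⟨ha, ha'⟩ ⟨hb, hb'⟩
    refine ⟨G.mul_mem ha hb, ?_⟩
    have : (a * b).2 ℓ = a.2 (b.2 ℓ) := rfl
    rw [this, hb', ha']
  inv_mem' := by
    rintro a ⟨ha, ha'⟩
    refine ⟨G.inv_mem ha, ?_⟩
    have h : a⁻¹.2 (a.2 ℓ) = ℓ := by simp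
    rw [ha'] at h
    exact h

/-- Isomorphism of incidence structures: a pair of bijections between the point sets and
the line sets preserving incidence in both directions. -/
def IsoTo {P L P' L' : Type*} (I : P → L → Prop) (I' : P' → L' → Prop) : Prop :=
  ∃ (e : P ≃ P') (f : L ≃ L'), ∀ p ℓ, I' (e p) (f ℓ) ↔ I p ℓ

end GQDefs

section ClassicalGQs

/-- The standard nondegenerate alternating bilinear form on `F^4`. -/
def sympForm {F : Type*} [Field F] (x y : Fin 4 → F) : F :=
  x 0 * y 1 - x 1 * y 0 + x 2 * y 3 - x 3 * y 2

/-- Points of `W(3,q)`: the `1`-dimensional subspaces of `F_q^4`. -/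
def W3Point (F : Type*) [Field F] : Type _ :=
  {W : Submodule F (Fin 4 → F) // Module.finrank F W = 1}

/-- Lines of `W(3,q)`: the `2`-dimensional totally isotropic subspaces of `F_q^4` with
respect to a nondegenerate alternating form. -/
def W3Line (F : Type*) [Field F] : Type _ :=
  {U : Submodule F (Fin 4 → F) //
    Module.finrank F U = 2 ∧ ∀ x ∈ U, ∀ y ∈ U, sympForm x y = 0}

/-- Incidence in `W(3,q)` is given by inclusion. -/
def W3Incid (F : Type*) [Field F] : W3Point F → W3Line F → Prop :=
  fun W U => W.1 ≤ U.1

/-- The standard nondegenerate Hermitian sesquilinear form on `F_{q²}^4`, relative to the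
field automorphism `x ↦ x^q`. -/
def hermForm3 {F : Type*} [Field F] (q : ℕ) (x y : Fin 4 → F) : F :=
  x 0 * y 1 ^ q + x 1 * y 0 ^ q + x 2 * y 3 ^ q + x 3 * y 2 ^ q

/-- The standard nondegenerate Hermitian sesquilinear form on `F_{q²}^5`, relative to the
field automorphism `x ↦ x^q`. -/
def hermForm4 {F : Type*} [Field F] (q : ℕ) (x y : Fin 5 → F) : F :=
  x 0 * y 1 ^ q + x 1 * y 0 ^ q + x 2 * y 3 ^ q + x 3 * y 2 ^ q + x 4 * y 4 ^ q

/-- Points of `H(3,q²)`: the `1`-dimensional isotropic subspaces of `F_{q²}^4`. -/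
def H3Point (F : Type*) [Field F] (q : ℕ) : Type _ :=
  {W : Submodule F (Fin 4 → F) //
    Module.finrank F W = 1 ∧ ∀ x ∈ W, hermForm3 q x x = 0}

/-- Lines of `H(3,q²)`: the `2`-dimensional totally isotropic subspaces of `F_{q²}^4`. -/
def H3Line (F : Type*) [Field F] (q : ℕ) : Type _ :=
  {U : Submodule F (Fin 4 → F) //
    Module.finrank F U = 2 ∧ ∀ x ∈ U, ∀ y ∈ U, hermForm3 q x y = 0}

/-- Incidence in `H(3,q²)` is given by inclusion. -/
def H3Incid (F : Type*) [Field F] (q : ℕ) : H3Point F q → H3Line F q → Prop :=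
  fun W U => W.1 ≤ U.1

/-- Points of `H(4,q²)`: the `1`-dimensional isotropic subspaces of `F_{q²}^5`. -/
def H4Point (F : Type*) [Field F] (q : ℕ) : Type _ :=
  {W : Submodule F (Fin 5 → F) //
    Module.finrank F W = 1 ∧ ∀ x ∈ W, hermForm4 q x x = 0}

/-- Lines of `H(4,q²)`: the `2`-dimensional totally isotropic subspaces of `F_{q²}^5`. -/
def H4Line (F : Type*) [Field F] (q : ℕ) : Type _ :=
  {U : Submodule F (Fin 5 → F) //
    Module.finrank F U = 2 ∧ ∀ x ∈ U, ∀ y ∈ U, hermForm4 q x y = 0}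

/-- Incidence in `H(4,q²)` is given by inclusion. -/
def H4Incid (F : Type*) [Field F] (q : ℕ) : H4Point F q → H4Line F q → Prop :=
  fun W U => W.1 ≤ U.1

end ClassicalGQs

section GQLemmas

variable {P L : Type*} {I : P → L → Prop} {s t : ℕ}

theorem Coll.symm {x y : P} (h : Coll I x y) : Coll I y x :=
  let ⟨ℓ, hx, hy⟩ := h
  ⟨ℓ, hy, hx⟩

/-- On every line there is a point avoiding two given points. -/
theorem IsGQ.exists_point_ne_ne [Finite P] (h : IsGQ I s t) (hs : 2 ≤ s) (ℓ : L) (a b : P) :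
    ∃ p, I p ℓ ∧ p ≠ a ∧ p ≠ b := by
  have hc : ({a, b} : Set P).ncard < {p | I p ℓ}.ncard := by
    have h1 : {p | I p ℓ}.ncard = s + 1 := h.point_count ℓ
    have h2 := Set.ncard_insert_le a {b}
    rw [Set.ncard_singleton] at h2
    omega
  obtain ⟨p, hp, hn⟩ := Set.exists_mem_notMem_of_ncard_lt_ncard hc
  simp only [Set.mem_insert_iff, Set.mem_singleton_iff, not_or] at hn
  exact ⟨p, hp, hn⟩

/-- Through every point there is a line different from a given one. -/
theorem IsGQ.exists_line_ne [Finite L] (h : IsGQ I s t) (ht : 2 ≤ t) (p : P) (m : L) :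
    ∃ ℓ, I p ℓ ∧ ℓ ≠ m := by
  have hc : ({m} : Set L).ncard < {ℓ | I p ℓ}.ncard := by
    have h1 : {ℓ | I p ℓ}.ncard = t + 1 := h.line_count p
    rw [Set.ncard_singleton]
    omega
  obtain ⟨ℓ, hℓ, hn⟩ := Set.exists_mem_notMem_of_ncard_lt_ncard hc
  exact ⟨ℓ, hℓ, hn⟩

theorem IsGQ.exists_line (h : IsGQ I s t) (p : P) : ∃ ℓ, I p ℓ := by
  have : 0 < Nat.card {ℓ : L // I p ℓ} := by rw [h.line_count p]; omega
  obtain ⟨⟨ℓ, hℓ⟩⟩ := (Nat.card_pos_iff.mp this).1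
  exact ⟨ℓ, hℓ⟩

/-- Every line carries a point collinear with a given point. -/
theorem IsGQ.exists_proj (h : IsGQ I s t) (p : P) (ℓ : L) : ∃ q, I q ℓ ∧ Coll I p q := by
  by_cases hp : I p ℓ
  · exact ⟨p, hp, ℓ, hp, hp⟩
  · obtain ⟨⟨q, m⟩, ⟨h1, h2, h3⟩, -⟩ := h.quad hp
    exact ⟨q, h3, m, h1, h2⟩

/-- There are no triangles: a point collinear with two points of a line lies on that line. -/
theorem IsGQ.incident_of_coll (h : IsGQ I s t) {a b w : P} {ℓ : L} (hab : a ≠ b)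
    (ha : I a ℓ) (hb : I b ℓ) (hwa : Coll I w a) (hwb : Coll I w b) : I w ℓ := by
  by_contra hw
  obtain ⟨m, hm1, hm2⟩ := hwa
  obtain ⟨n, hn1, hn2⟩ := hwb
  have := (h.quad hw).unique (y₁ := (a, m)) (y₂ := (b, n)) ⟨hm1, hm2, ha⟩ ⟨hn1, hn2, hb⟩
  exact hab (congrArg Prod.fst this)

theorem IsGQ.exists_not_coll [Finite P] [Finite L] (h : IsGQ I s t) (hs : 2 ≤ s) (ht : 2 ≤ t)
    (x : P) : ∃ z, ¬ Coll I z x := by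
  obtain ⟨m, hxm⟩ := h.exists_line x
  obtain ⟨y, hym, hyx, -⟩ := h.exists_point_ne_ne hs m x x
  obtain ⟨n, hyn, hnm⟩ := h.exists_line_ne ht y m
  obtain ⟨z, hzn, hzy, -⟩ := h.exists_point_ne_ne hs n y y
  refine ⟨z, fun hzx => hnm ?_⟩
  have hxn : I x n := h.incident_of_coll hzy hzn hyn hzx.symm ⟨m, hxm, hym⟩
  exact h.unique_line hyx hyn hxn hym hxm

theorem Coll.map {g : Perm P × Perm L} (hg : g ∈ autGroup I) {x y : P} (h : Coll I x y) :
    Coll I (g.1 x) (g.1 y) :=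
  let ⟨ℓ, hx, hy⟩ := h
  ⟨g.2 ℓ, (hg x ℓ).2 hx, (hg y ℓ).2 hy⟩

/-- The fixed points of a symmetry that are not collinear with its center are closed under
collinearity. -/
theorem IsGQ.symm_fixed_of_coll [Finite L] (h : IsGQ I s t) (ht : 2 ≤ t)
    {g : Perm P × Perm L} {x z p : P} (hg : g ∈ symmGroup I z) (hx : ¬ Coll I z x)
    (hp : ¬ Coll I z p) (hxp : Coll I x p) (hgx : g.1 x = x) : g.1 p = p := by
  obtain ⟨hga, hgz⟩ := hg
  by_cases hne : x = p
  · rw [← hne, hgx]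
  obtain ⟨ℓ, hxℓ, hpℓ⟩ := hxp
  obtain ⟨q, hqℓ, hzq⟩ := h.exists_proj z ℓ
  have hqx : q ≠ x := by rintro rfl; exact hx hzq
  have hgℓ : g.2 ℓ = ℓ := by
    refine h.unique_line hqx ?_ ?_ hqℓ hxℓ
    · simpa only [hgz q hzq] using (hga q ℓ).2 hqℓ
    · simpa only [hgx] using (hga x ℓ).2 hxℓ
  have hgpℓ : I (g.1 p) ℓ := by simpa only [hgℓ] using (hga p ℓ).2 hpℓ
  obtain ⟨m, hpm, hmℓ⟩ := h.exists_line_ne ht p ℓ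
  obtain ⟨w, hwm, hzw⟩ := h.exists_proj z m
  have hwp : w ≠ p := by rintro rfl; exact hp hzw
  have hc : Coll I w p := ⟨m, hwm, hpm⟩
  have hc' : Coll I w (g.1 p) := by simpa only [hgz w hzw] using hc.map hga
  by_contra hmove
  have hwℓ : I w ℓ := h.incident_of_coll hmove hgpℓ hpℓ hc' hc
  exact hmℓ (h.unique_line hwp hwm hpm hwℓ hpℓ)

/-- An automorphism fixing all points is trivial. -/
theorem IsGQ.eq_one_of_fixed [Finite P] (h : IsGQ I s t) (hs : 2 ≤ s)
    {g : Perm P × Perm L} (hg : g ∈ autGroup I) (hfix : ∀ p, g.1 p = p) : g = 1 := by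
  refine Prod.ext (Equiv.ext hfix) (Equiv.ext fun ℓ => ?_)
  have hinc : ∀ p, I p ℓ → I p (g.2 ℓ) := fun p hp => by
    simpa only [hfix p] using (hg p ℓ).2 hp
  obtain ⟨a, ha⟩ : ∃ a, I a ℓ := by
    have : 0 < Nat.card {p : P // I p ℓ} := by rw [h.point_count ℓ]; omega
    obtain ⟨⟨a, ha⟩⟩ := (Nat.card_pos_iff.mp this).1
    exact ⟨a, ha⟩
  obtain ⟨b, hb, hba, -⟩ := h.exists_point_ne_ne hs ℓ a a
  exact h.unique_line hba (hinc b hb) (hinc a ha) hb ha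

/-- A symmetry fixing a point not collinear with its center is trivial. -/
theorem IsGQ.symm_eq_one_of_fixed [Finite P] [Finite L] (h : IsGQ I s t) (hs : 2 ≤ s)
    (ht : 2 ≤ t) {g : Perm P × Perm L} {x z : P} (hg : g ∈ symmGroup I z)
    (hx : ¬ Coll I z x) (hgx : g.1 x = x) : g = 1 := by
  refine h.eq_one_of_fixed hs hg.1 fun p => ?_
  by_cases hp : Coll I z p
  · exact hg.2 p hp
  by_contra hmove
  have hfix : ∀ q, Coll I x q → g.1 q = q := fun q hxq => by
    by_cases hq : Coll I z q
    · exact hg.2 q hq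
    · exact h.symm_fixed_of_coll ht hg hx hq hxq hgx
  have hmoved : ∀ q, ¬ Coll I z q → Coll I q p → g.1 q ≠ q := fun q hq hqp hgq =>
    hmove (h.symm_fixed_of_coll ht hg hq hp hqp hgq)
  obtain ⟨m, hpm⟩ := h.exists_line p
  obtain ⟨v, hvm, hxv⟩ := h.exists_proj x m
  have hzv : Coll I z v := by
    by_contra hzv
    exact hmoved v hzv ⟨m, hvm, hpm⟩ (hfix v hxv)
  obtain ⟨p', hp'm, hp'p, hp'v⟩ := h.exists_point_ne_ne hs m p v
  have hzp' : ¬ Coll I z p' := fun hc =>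
    hp ⟨m, h.incident_of_coll hp'v hp'm hvm hc hzv, hpm⟩
  obtain ⟨n, hp'n, hnm⟩ := h.exists_line_ne ht p' m
  obtain ⟨w, hwn, hxw⟩ := h.exists_proj x n
  have hzw : Coll I z w := by
    by_contra hzw
    exact hmoved p' hzp' ⟨m, hp'm, hpm⟩
      (h.symm_fixed_of_coll ht hg hzw hzp' ⟨n, hwn, hp'n⟩ (hfix w hxw))
  obtain ⟨k, hxk, hwk⟩ := hxw
  obtain ⟨q, hqk, hpq⟩ := h.exists_proj p k
  have hzq : Coll I z q := by
    by_contra hzq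
    exact hmoved q hzq hpq.symm (hfix q ⟨k, hxk, hqk⟩)
  have hqw : q = w := by
    by_contra hqw
    exact hx ⟨k, h.incident_of_coll hqw hqk hwk hzq hzw, hxk⟩
  subst hqw
  have hqm : I q m := h.incident_of_coll hp'p hp'm hpm ⟨n, hwn, hp'n⟩ hpq.symm
  have hqp' : q ≠ p' := by rintro rfl; exact hzp' hzq
  exact hnm (h.unique_line hqp' hwn hp'n hqm hp'm)

/-- A nontrivial symmetry maps a point not collinear with its center to a point not collinear
with the original one. -/
theorem IsGQ.not_coll_symm_apply [Finite P] [Finite L] (h : IsGQ I s t) (hs : 2 ≤ s)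
    (ht : 2 ≤ t) {g : Perm P × Perm L} {x z : P} (hg : g ∈ symmGroup I z) (hg1 : g ≠ 1)
    (hx : ¬ Coll I z x) : ¬ Coll I (g.1 x) x := by
  have hgx : g.1 x ≠ x := fun hgx => hg1 (h.symm_eq_one_of_fixed hs ht hg hx hgx)
  rintro ⟨m, hgxm, hxm⟩
  have hperp : ∀ w, Coll I x w → Coll I z w → I w m := fun w hxw hzw => by
    refine h.incident_of_coll hgx hgxm hxm ?_ hxw.symm
    simpa only [hg.2 w hzw] using hxw.symm.map hg.1
  obtain ⟨n, hzn⟩ := h.exists_line z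
  obtain ⟨k, hzk, hkn⟩ := h.exists_line_ne ht z n
  obtain ⟨u, hun, hxu⟩ := h.exists_proj x n
  obtain ⟨v, hvk, hxv⟩ := h.exists_proj x k
  have huv : u = v := by
    by_contra huv
    have hum := hperp u hxu ⟨n, hzn, hun⟩
    have hvm := hperp v hxv ⟨k, hzk, hvk⟩
    exact hx ⟨m, h.incident_of_coll huv hum hvm ⟨n, hzn, hun⟩ ⟨k, hzk, hvk⟩, hxm⟩
  subst huv
  have huz : u ≠ z := by rintro rfl; exact hx hxu.symm
  exact hkn (h.unique_line huz hvk hzk hun hzn)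

theorem conj_mem_symmGroup {g e : Perm P × Perm L} (hg : g ∈ autGroup I) {y : P}
    (he : e ∈ symmGroup I y) : g * e * g⁻¹ ∈ symmGroup I (g.1 y) := by
  refine ⟨mul_mem (mul_mem hg he.1) (inv_mem hg), fun w hw => ?_⟩
  have hw' : Coll I y (g⁻¹.1 w) := by
    simpa using hw.map (inv_mem hg)
  have hfix := he.2 _ hw'
  change g.1 (e.1 (g⁻¹.1 w)) = w
  rw [hfix]
  simp

/-- The set of `r`-points is invariant under automorphisms. -/
theorem apply_mem_Pr {g : Perm P × Perm L} (hg : g ∈ autGroup I) {r : ℕ} {y : P}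
    (hy : y ∈ Pr I r) : g.1 y ∈ Pr I r := by
  have hmap : (symmGroup I y).map (MulAut.conj g).toMonoidHom = symmGroup I (g.1 y) := by
    ext e
    constructor
    · rintro ⟨e', he', rfl⟩
      exact conj_mem_symmGroup hg he'
    · intro he
      refine ⟨g⁻¹ * e * g, ?_, ?_⟩
      · have := conj_mem_symmGroup (inv_mem hg) he
        simpa using this
      · simp [mul_assoc]
  have hcard := Nat.card_congr ((symmGroup I y).equivMapOfInjective
    (MulAut.conj g).toMonoidHom (MulAut.conj g).injective).toEquiv
  rw [hmap] at hcard
  change r ∣ Nat.card (symmGroup I (g.1 y))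
  rw [← hcard]
  exact hy

end GQLemmas

/-- If every point has a nontrivial full group of symmetries and the set `P_r` of
`r`-points is nonempty, then `P_r` has at least `3` elements and is not contained in the
point set of a single line. -/
theorem Pr_card_and_not_on_line {P L : Type} [Finite P] [Finite L]
    (I : P → L → Prop) (s t : ℕ) (hGQ : IsGQ I s t) (hs : 2 ≤ s) (ht : 2 ≤ t)
    (hE : ∀ x : P, symmGroup I x ≠ ⊥)
    (r : ℕ) (hr : r.Prime) (hne : (Pr I r).Nonempty) :
    3 ≤ (Pr I r).ncard ∧ ¬ ∃ ℓ : L, ∀ y ∈ Pr I r, I y ℓ := by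
  obtain ⟨x, hx⟩ := hne
  obtain ⟨z, hzx⟩ := hGQ.exists_not_coll hs ht x
  obtain ⟨g, hg, hg1⟩ := (symmGroup I z).bot_or_exists_ne_one.resolve_left (hE z)
  have hgx := hGQ.not_coll_symm_apply hs ht hg hg1 hzx
  have hgxr : g.1 x ∈ Pr I r := apply_mem_Pr hg.1 hx
  obtain ⟨k, hk, hk1⟩ :=
    (symmGroup I (g.1 x)).bot_or_exists_ne_one.resolve_left (hE (g.1 x))
  have hkx := hGQ.not_coll_symm_apply hs ht hk hk1 hgx
  have hkxr : k.1 x ∈ Pr I r := apply_mem_Pr hk.1 hx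
  have hrefl : Coll I x x := (hGQ.exists_line x).imp fun _ h => ⟨h, h⟩
  have hrefl' : Coll I (g.1 x) (g.1 x) := hrefl.map hg.1
  have hgx_ne : x ≠ g.1 x := fun he => hgx (he ▸ hrefl)
  have hkx_ne : x ≠ k.1 x := fun he => hkx (he ▸ hrefl)
  have hne : g.1 x ≠ k.1 x := fun he => hgx_ne
    (k.1.injective (((hk.2 _ hrefl').trans he).symm))
  refine ⟨?_, fun ⟨ℓ, hℓ⟩ => hgx ⟨ℓ, hℓ _ hgxr, hℓ _ hx⟩⟩
  have hsub : ({x, g.1 x, k.1 x} : Set P) ⊆ Pr I r := by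
    rintro w (rfl | rfl | rfl) <;> assumption
  have hcard : ({x, g.1 x, k.1 x} : Set P).ncard = 3 :=
    Set.ncard_eq_three.2 ⟨_, _, _, hgx_ne, hkx_ne, hne, rfl⟩
  exact hcard ▸ Set.ncard_le_ncard hsub
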